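/- Let f : ℝ^d → ℝ be μ-strongly convex, differentiable, and L-smooth with 0 < μ ≤ L, let ψ : ℝ^d → ℝ be convex, let F = f + ψ, and let x* be a minimizer of F over ℝ^d. Fix x_k ∈ ℝ^d, η > 0, and v > 0. Let g_k be a random vector in ℝ^d (on some probability space) satisfying ‖E[g_k] − ∇f(x_k)‖ ≤ L·v·(d + 3)^{3/2}, and let x_{k+1} be the random point where, for each sample, x_{k+1} is the unique minimizer over y ∈ ℝ^d of ψ(y) + (1/(2η))·‖y − (x_k − η·g_k)‖² (the proximal step x_{k+1} = prox_{ηψ}(x_k − η g_k)). Then E[‖x_{k+1} − x*‖²] ≤ (1 − (μ/2)·η)·‖x_k − x*‖² − 2η·(f(x_k) − f(x*) − ⟨∇f(x*), x_k − x*⟩) + 2(d + 3)³·L²·v²·η/μ + η²·E[‖g_k − ∇f(x*)‖²]. -/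

import Mathlib

open MeasureTheory ProbabilityTheory Real
open scoped RealInnerProductSpace

/-- If `p` minimizes `φ + ψ` with `ψ` convex and `φ` differentiable at `p`, then minus the
derivative of `φ` at `p` is a subgradient of `ψ` at `p`. -/
lemma ConvexOn.sub_le_of_isMinOn_add {E : Type*} [NormedAddCommGroup E] [NormedSpace ℝ E]
    {φ ψ : E → ℝ} {φ' : E →L[ℝ] ℝ} {p : E} (hψ : ConvexOn ℝ Set.univ ψ)
    (hφ : HasFDerivAt φ φ' p) (hp : ∀ y, φ p + ψ p ≤ φ y + ψ y) (y : E) :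
    ψ p - φ' (y - p) ≤ ψ y := by
  have hline : HasDerivAt (fun t : ℝ => p + t • (y - p)) (y - p) 0 := by
    simpa using ((hasDerivAt_id (0 : ℝ)).smul_const (y - p)).const_add p
  have hφ0 : HasFDerivAt φ φ' (p + (0 : ℝ) • (y - p)) := by simpa using hφ
  have hder := (hφ0.comp_hasDerivAt (0 : ℝ) hline).hasDerivWithinAt (s := Set.Ioi 0)
  rw [hasDerivWithinAt_iff_tendsto_slope' (by simp)] at hder
  have hmem : Set.Ioc (0 : ℝ) 1 ∈ nhdsWithin (0 : ℝ) (Set.Ioi 0) :=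
    Ioc_mem_nhdsGT one_pos
  have hle : ψ p - ψ y ≤ φ' (y - p) := by
    refine ge_of_tendsto hder (Filter.mem_of_superset hmem ?_)
    rintro t ⟨ht0, ht1⟩
    have hconv := hψ.2 (Set.mem_univ p) (Set.mem_univ y) (sub_nonneg.2 ht1) ht0.le (by ring)
    have hpt : (1 - t) • p + t • y = p + t • (y - p) := by module
    rw [hpt, smul_eq_mul, smul_eq_mul] at hconv
    have hmin := hp (p + t • (y - p))
    simp only [Set.mem_ofPred_eq, slope_def_field, Function.comp_apply, zero_smul, add_zero,
      sub_zero]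
    rw [le_div_iff₀ ht0]
    linarith
  linarith

/-- The proximal step does not increase the distance to a minimizer `q` of `f + ψ`, compared
with the forward step taken from `q` along `∇f q`. -/
lemma norm_prox_sub_sq_le {E : Type*} [NormedAddCommGroup E] [InnerProductSpace ℝ E]
    [CompleteSpace E] {f ψ : E → ℝ} {η : ℝ} (hη : 0 < η) {p q x g : E}
    (hψ : ConvexOn ℝ Set.univ ψ) (hf : DifferentiableAt ℝ f q)
    (hq : ∀ y, f q + ψ q ≤ f y + ψ y)
    (hp : IsMinOn (fun y => ψ y + 1 / (2 * η) * ‖y - (x - η • g)‖ ^ 2) Set.univ p) :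
    ‖p - q‖ ^ 2 ≤ ‖x - q‖ ^ 2 - 2 * η * ⟪x - q, g - gradient f q⟫
      + η ^ 2 * ‖g - gradient f q‖ ^ 2 := by
  have hsub_q := hψ.sub_le_of_isMinOn_add hf.hasGradientAt.hasFDerivAt hq p
  have hφ : HasFDerivAt (fun y => 1 / (2 * η) * ‖y - (x - η • g)‖ ^ 2)
      (η⁻¹ • innerSL ℝ (p - (x - η • g))) p := by
    refine ((((hasFDerivAt_id p).sub_const (x - η • g)).norm_sq).const_mul
      (1 / (2 * η))).congr_fderiv ?_
    ext u
    simp only [smul_apply, ContinuousLinearMap.comp_apply, innerSL_apply_apply,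
      ContinuousLinearMap.id_apply, id_eq, smul_eq_mul, nsmul_eq_mul, Nat.cast_ofNat]
    field_simp
  have hsub_p := hψ.sub_le_of_isMinOn_add hφ
    (fun y => by have := isMinOn_iff.1 hp y (Set.mem_univ y); linarith) q
  simp only [InnerProductSpace.toDual_apply_apply] at hsub_q
  simp only [smul_apply, innerSL_apply_apply, smul_eq_mul] at hsub_p
  set G := gradient f q
  have hkey : ⟪p - (x - η • g), p - q⟫ - η * ⟪G, p - q⟫ ≤ 0 := by
    have hflip : ⟪p - (x - η • g), q - p⟫ = -⟪p - (x - η • g), p - q⟫ := by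
      rw [← inner_neg_right, neg_sub]
    rw [hflip] at hsub_p
    have hsum : η⁻¹ * ⟪p - (x - η • g), p - q⟫ ≤ ⟪G, p - q⟫ := by linarith
    have := (inv_mul_le_iff₀ hη).1 hsum
    linarith
  have hsplit : ⟪p - (x - η • g), p - q⟫ - η * ⟪G, p - q⟫
      = ‖p - q‖ ^ 2 - ⟪(x - q) - η • (g - G), p - q⟫ := by
    rw [← real_inner_self_eq_norm_sq, ← real_inner_smul_left, ← inner_sub_left, ← inner_sub_left]
    congr 1
    module
  have hsq := sq_nonneg ‖((x - q) - η • (g - G)) - (p - q)‖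
  rw [norm_sub_sq_real] at hsq
  have hexp : ‖(x - q) - η • (g - G)‖ ^ 2
      = ‖x - q‖ ^ 2 - 2 * η * ⟪x - q, g - G⟫ + η ^ 2 * ‖g - G‖ ^ 2 := by
    rw [norm_sub_sq_real, real_inner_smul_right, norm_smul, Real.norm_eq_abs, mul_pow, sq_abs]
    ring
  linarith

/-- One proximal step with a nearly unbiased stochastic gradient.
`f` is `μ`-strongly convex, differentiable and `L`-smooth (`0 < μ ≤ L`), `ψ` is convex,
`x*` minimizes `F = f + ψ`.  For a random vector `g_k` with
`‖E[g_k] − ∇f(x_k)‖ ≤ L v (d+3)^{3/2}` and `x_{k+1} = prox_{ηψ}(x_k − η g_k)` samplewise,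
`E[‖x_{k+1} − x*‖²] ≤ (1 − (μ/2)η) ‖x_k − x*‖² − 2η (f(x_k) − f(x*) − ⟪∇f(x*), x_k − x*⟫)
  + 2(d+3)³ L² v² η / μ + η² E[‖g_k − ∇f(x*)‖²]`. -/
theorem zpdvr_x_recursion {d : ℕ} {μ L v η : ℝ}
    (hμ : 0 < μ) (hμL : μ ≤ L) (hv : 0 < v) (hη : 0 < η)
    (f ψ : EuclideanSpace ℝ (Fin d) → ℝ)
    (hdiff : Differentiable ℝ f)
    (hstrong : ∀ x₁ x₂, f x₁ ≥ f x₂ + ⟪gradient f x₂, x₁ - x₂⟫ + μ / 2 * ‖x₁ - x₂‖ ^ 2)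
    (hsmooth : ∀ x y, ‖gradient f x - gradient f y‖ ≤ L * ‖x - y‖)
    (hψ : ConvexOn ℝ Set.univ ψ)
    (xstar : EuclideanSpace ℝ (Fin d))
    (hmin : ∀ y, f xstar + ψ xstar ≤ f y + ψ y)
    (xk : EuclideanSpace ℝ (Fin d))
    {Ω : Type*} [MeasureSpace Ω] {P : Measure Ω} [IsProbabilityMeasure P]
    (gk : Ω → EuclideanSpace ℝ (Fin d))
    (hgk_int : Integrable gk P)
    (hgk_sq_int : Integrable (fun ω => ‖gk ω - gradient f xstar‖ ^ 2) P)
    (hbias : ‖(∫ ω, gk ω ∂P) - gradient f xk‖ ≤ L * v * ((d : ℝ) + 3) ^ ((3 : ℝ) / 2))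
    (xnext : Ω → EuclideanSpace ℝ (Fin d))
    (hxnext_meas : AEStronglyMeasurable xnext P)
    (hprox : ∀ ω, IsMinOn (fun y => ψ y + 1 / (2 * η) * ‖y - (xk - η • gk ω)‖ ^ 2)
      Set.univ (xnext ω)) :
    (∫ ω, ‖xnext ω - xstar‖ ^ 2 ∂P)
      ≤ (1 - μ / 2 * η) * ‖xk - xstar‖ ^ 2
        - 2 * η * (f xk - f xstar - ⟪gradient f xstar, xk - xstar⟫)
        + 2 * ((d : ℝ) + 3) ^ 3 * L ^ 2 * v ^ 2 * η / μ
        + η ^ 2 * ∫ ω, ‖gk ω - gradient f xstar‖ ^ 2 ∂P := by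
  set G := gradient f xstar
  set a := xk - xstar
  set B := L * v * ((d : ℝ) + 3) ^ ((3 : ℝ) / 2) with hB
  have hdiff_int : Integrable (fun ω => gk ω - G) P := hgk_int.sub (integrable_const G)
  have hinner_int : Integrable (fun ω => ⟪a, gk ω - G⟫) P := hdiff_int.const_inner a
  have hlin_int : Integrable (fun ω => ‖a‖ ^ 2 - 2 * η * ⟪a, gk ω - G⟫) P :=
    (integrable_const _).sub (hinner_int.const_mul _)
  have hmono : (∫ ω, ‖xnext ω - xstar‖ ^ 2 ∂P)
      ≤ ∫ ω, (‖a‖ ^ 2 - 2 * η * ⟪a, gk ω - G⟫ + η ^ 2 * ‖gk ω - G‖ ^ 2) ∂P :=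
    integral_mono_of_nonneg (.of_forall fun ω => by positivity)
      (hlin_int.add (hgk_sq_int.const_mul _))
      (.of_forall fun ω => norm_prox_sub_sq_le hη hψ (hdiff xstar) hmin (hprox ω))
  have hmean : ∫ ω, ⟪a, gk ω - G⟫ ∂P = ⟪a, (∫ ω, gk ω ∂P) - G⟫ := by
    rw [integral_inner hdiff_int, integral_sub hgk_int (integrable_const G)]
    simp
  rw [integral_add hlin_int (hgk_sq_int.const_mul _),
    integral_sub (integrable_const _) (hinner_int.const_mul _), integral_const_mul,
    integral_const_mul, hmean] at hmono
  simp only [integral_const, probReal_univ, one_smul] at hmono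
  have hsplit : ⟪a, (∫ ω, gk ω ∂P) - G⟫
      = ⟪gradient f xk, a⟫ - ⟪G, a⟫ + ⟪a, (∫ ω, gk ω ∂P) - gradient f xk⟫ := by
    rw [inner_sub_right a, inner_sub_right a, real_inner_comm a G,
      real_inner_comm a (gradient f xk)]
    ring
  have hsc := hstrong xstar xk
  rw [← neg_sub xk xstar, inner_neg_right, norm_neg] at hsc
  have hcs : -(‖a‖ * B) ≤ ⟪a, (∫ ω, gk ω ∂P) - gradient f xk⟫ :=
    (neg_le_neg (mul_le_mul_of_nonneg_left hbias (norm_nonneg a))).trans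
      (neg_le_of_abs_le (abs_real_inner_le_norm _ _))
  have hyoung : 2 * (‖a‖ * B) ≤ μ / 2 * ‖a‖ ^ 2 + 2 * B ^ 2 / μ := by
    have : μ / 2 * ‖a‖ ^ 2 + 2 * B ^ 2 / μ - 2 * (‖a‖ * B)
        = (μ * ‖a‖ - 2 * B) ^ 2 / (2 * μ) := by
      field_simp
      ring
    have : 0 ≤ (μ * ‖a‖ - 2 * B) ^ 2 / (2 * μ) := by positivity
    linarith
  have hB2 : B ^ 2 = ((d : ℝ) + 3) ^ 3 * L ^ 2 * v ^ 2 := by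
    have hpow : (((d : ℝ) + 3) ^ ((3 : ℝ) / 2)) ^ 2 = ((d : ℝ) + 3) ^ 3 := by
      rw [← Real.rpow_natCast, ← Real.rpow_mul (by positivity), ← Real.rpow_natCast]
      norm_num
    rw [hB, mul_pow, mul_pow, hpow]
    ring
  have hterm : 2 * ((d : ℝ) + 3) ^ 3 * L ^ 2 * v ^ 2 * η / μ = η * (2 * B ^ 2 / μ) := by
    rw [hB2]
    ring
  have hcombined : -(2 * ⟪a, (∫ ω, gk ω ∂P) - G⟫) ≤ -(μ / 2 * ‖a‖ ^ 2)
      - 2 * (f xk - f xstar - ⟪G, a⟫) + 2 * B ^ 2 / μ := by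
    rw [hsplit]
    linarith
  have hscaled := mul_le_mul_of_nonneg_left hcombined hη.le
  rw [hterm]
  linarith
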